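/- arXiv:2209.09562 — 6 statements merged into one kernel-verified Lean document; each statement's English description precedes it below -/
import Mathlib

section
/- Let M, T > 0 be real constants, let p0, pm, pm' be real numbers with 0 ≤ p0 < 1, pm ≥ 0, pm' ≥ 0, and pm + pm' > 0. Define S1 = Σ_{j=1}^∞ [ j·M·T·p0^{j-1}·(pm² + pm'²) + (j·M·T + M·T/2)·p0^{j-1}·pm'·pm + (j·M·T − M·T/2)·p0^{j-1}·pm·pm' ] and S2 = Σ_{j=1}^∞ [ j²·M²·T²·p0^{j-1}·(pm² + pm'²) + (j·M·T + M·T/2)²·p0^{j-1}·pm'·pm + (j·M·T − M·T/2)²·p0^{j-1}·pm·pm' ]. Then T + S2/(2·S1) = T + Δ(p0, pm, pm'), where Δ(x, y, z) := (M·T/4)·(2·(y+z)²·(1+x) + y·z·(1−x)²)/((y+z)²·(1−x)). -/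
/-- Lemma 1 of the paper: the normalized average AoI of CR-NOMA under the
generate-at-will model, T + E{Y²}/(2·E{Y}), equals T + Δ(p0, pm, pm') where
Δ(x, y, z) = (M·T/4)·(2·(y+z)²·(1+x) + y·z·(1−x)²)/((y+z)²·(1−x)). -/
theorem stmt_2 (M T p0 pm pm' : ℝ) (hM : 0 < M) (hT : 0 < T)
    (hp0 : 0 ≤ p0) (hp1 : p0 < 1) (hpm : 0 ≤ pm) (hpm' : 0 ≤ pm')
    (hsum : 0 < pm + pm')
    (S1 S2 : ℝ)
    (hS1 : S1 = ∑' j : ℕ,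
        (((j : ℝ) + 1) * M * T * p0 ^ j * (pm ^ 2 + pm' ^ 2)
        + (((j : ℝ) + 1) * M * T + M * T / 2) * p0 ^ j * pm' * pm
        + (((j : ℝ) + 1) * M * T - M * T / 2) * p0 ^ j * pm * pm'))
    (hS2 : S2 = ∑' j : ℕ,
        (((j : ℝ) + 1) ^ 2 * M ^ 2 * T ^ 2 * p0 ^ j * (pm ^ 2 + pm' ^ 2)
        + (((j : ℝ) + 1) * M * T + M * T / 2) ^ 2 * p0 ^ j * pm' * pm
        + (((j : ℝ) + 1) * M * T - M * T / 2) ^ 2 * p0 ^ j * pm * pm')) :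
    T + S2 / (2 * S1) =
      T + (M * T / 4) * (2 * (pm + pm') ^ 2 * (1 + p0) + pm * pm' * (1 - p0) ^ 2)
        / ((pm + pm') ^ 2 * (1 - p0)) := by
  have hr : ‖p0‖ < 1 := by rw [Real.norm_eq_abs, abs_of_nonneg hp0]; exact hp1
  have h0 := hasSum_choose_mul_geometric_of_norm_lt_one 0 hr
  have h1 := hasSum_choose_mul_geometric_of_norm_lt_one 1 hr
  have h2 := hasSum_choose_mul_geometric_of_norm_lt_one 2 hr
  have hc : ∀ n : ℕ, (((n + 2).choose 2 : ℕ) : ℝ) = ((n : ℝ) + 2) * (n + 1) / 2 := by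
    intro n
    rw [Nat.cast_choose_two]
    push_cast
    ring
  have hq : (1 - p0) ≠ 0 := by linarith
  have hs : pm + pm' ≠ 0 := hsum.ne'
  have e1 : S1 = M * T * (pm + pm') ^ 2 / (1 - p0) ^ 2 := by
    rw [hS1]
    have h := h1.mul_left (M * T * (pm + pm') ^ 2)
    rw [← (h.tsum_eq.trans (by ring : _ = M * T * (pm + pm') ^ 2 / (1 - p0) ^ 2))]
    refine tsum_congr fun n => ?_
    rw [Nat.choose_one_right]
    push_cast
    ring
  have e2 : S2 = M ^ 2 * T ^ 2 * ((pm + pm') ^ 2 * (1 + p0) / (1 - p0) ^ 3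
      + pm * pm' / 2 / (1 - p0)) := by
    rw [hS2]
    have h := ((h2.mul_left (2 * M ^ 2 * T ^ 2 * (pm + pm') ^ 2)).sub
      (h1.mul_left (M ^ 2 * T ^ 2 * (pm + pm') ^ 2))).add
      (h0.mul_left (M ^ 2 * T ^ 2 * (pm * pm' / 2)))
    refine Eq.trans (tsum_congr fun n => ?_) (h.tsum_eq.trans ?_)
    · rw [hc, Nat.choose_one_right, Nat.choose_zero_right]
      push_cast
      ring
    · field_simp
      ring
  rw [e1, e2]
  congr 1
  field_simp
  ring
end

section
/- Let X and Y be independent random variables, each exponentially distributed with rate 1, and let P, P^S, ε > 0 be reals. Then P( P·X ≤ ε and P^S·Y ≤ ε·(P·X + 1) ) = 1 − e^{−ε/P} − e^{−ε/P^S} · (1 − e^{−(ε·P/P^S + 1)·ε/P}) / (ε·P/P^S + 1). -/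
open MeasureTheory ProbabilityTheory

lemma expM_Iic (t : ℝ) (ht : 0 ≤ t) :
    expMeasure 1 (Set.Iic t) = ENNReal.ofReal (1 - Real.exp (-t)) := by
  have h := lintegral_exponentialPDF_eq_antiDeriv (r := 1) one_pos t
  rw [if_pos ht, one_mul] at h
  rw [← h, expMeasure, gammaMeasure, withDensity_apply _ measurableSet_Iic]
  rfl

lemma int_aux (a b c : ℝ) (hc : c + 1 ≠ 0) :
    ∫ x in (0:ℝ)..a, Real.exp (-x) * (1 - Real.exp (-(c * x + b))) =
      1 - Real.exp (-a) - Real.exp (-b) * (1 - Real.exp (-(c + 1) * a)) / (c + 1) := by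
  have hd : ∀ x ∈ Set.uIcc 0 a, HasDerivAt
      (fun x => -Real.exp (-x) + Real.exp (-b) * Real.exp (-(c + 1) * x) / (c + 1))
      (Real.exp (-x) * (1 - Real.exp (-(c * x + b)))) x := by
    intro x _
    have h1 : HasDerivAt (fun x : ℝ => -Real.exp (-x)) (-(Real.exp (-x) * (-1))) x :=
      ((hasDerivAt_id x).neg.exp).neg
    have h2 : HasDerivAt (fun x : ℝ => Real.exp (-(c + 1) * x))
        (Real.exp (-(c + 1) * x) * (-(c + 1) * 1)) x :=
      ((hasDerivAt_id x).const_mul (-(c + 1))).exp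
    refine (h1.add ((h2.const_mul (Real.exp (-b))).div_const (c + 1))).congr_deriv ?_
    have e : Real.exp (-(c + 1) * x) = Real.exp (-x) * Real.exp (-(c * x)) := by
      rw [← Real.exp_add]; congr 1; ring
    have e2 : Real.exp (-(c * x + b)) = Real.exp (-(c * x)) * Real.exp (-b) := by
      rw [← Real.exp_add]; congr 1; ring
    rw [e, e2]
    field_simp
    ring
  rw [intervalIntegral.integral_eq_sub_of_hasDerivAt hd
    (Continuous.intervalIntegrable (by fun_prop) _ _)]
  simp
  field_simp
  ring

/-- Probability P(E1) of equation (37): for independent exponential(1) random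
variables X, Y, P(P·X ≤ ε and P^S·Y ≤ ε·(P·X + 1))
= 1 − e^{−ε/P} − e^{−ε/P^S}·(1 − e^{−(ε·P/P^S + 1)·ε/P})/(ε·P/P^S + 1). -/
theorem stmt_7 {Ω : Type*} [MeasurableSpace Ω] (μ : Measure Ω) [IsProbabilityMeasure μ]
    (X Y : Ω → ℝ) (hX : Measurable X) (hY : Measurable Y)
    (hindep : IndepFun X Y μ)
    (hXd : Measure.map X μ = expMeasure 1) (hYd : Measure.map Y μ = expMeasure 1)
    (P PS ε : ℝ) (hP : 0 < P) (hPS : 0 < PS) (hε : 0 < ε) :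
    μ {ω | P * X ω ≤ ε ∧ PS * Y ω ≤ ε * (P * X ω + 1)} =
      ENNReal.ofReal (1 - Real.exp (-ε / P)
        - Real.exp (-ε / PS) * (1 - Real.exp (-(ε * P / PS + 1) * ε / P))
          / (ε * P / PS + 1)) := by
  have hm : MeasurableSet {p : ℝ × ℝ | P * p.1 ≤ ε ∧ PS * p.2 ≤ ε * (P * p.1 + 1)} :=
    by
    have hset : {p : ℝ × ℝ | P * p.1 ≤ ε ∧ PS * p.2 ≤ ε * (P * p.1 + 1)} =
        {p : ℝ × ℝ | P * p.1 ≤ ε} ∩ {p : ℝ × ℝ | PS * p.2 ≤ ε * (P * p.1 + 1)} := by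
      ext p; simp
    rw [hset]
    refine MeasurableSet.inter ?_ ?_
    · exact measurableSet_le (by fun_prop) (by fun_prop)
    · exact measurableSet_le (by fun_prop) (by fun_prop)
  have : IsProbabilityMeasure (expMeasure 1) := isProbabilityMeasure_expMeasure one_pos
  have hj := (indepFun_iff_map_prod_eq_prod_map_map hX.aemeasurable hY.aemeasurable).1 hindep
  have h1 : μ {ω | P * X ω ≤ ε ∧ PS * Y ω ≤ ε * (P * X ω + 1)} =
      ((expMeasure 1).prod (expMeasure 1))
        {p : ℝ × ℝ | P * p.1 ≤ ε ∧ PS * p.2 ≤ ε * (P * p.1 + 1)} := by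
    conv_rhs => rw [← hXd]
    rw [hXd]
    have : (expMeasure 1).prod (expMeasure 1) = μ.map (fun ω => (X ω, Y ω)) := by
      rw [hj, hXd, hYd]
    rw [this, Measure.map_apply (hX.prodMk hY) hm]
    rfl
  have hpos : 0 < ε * P / PS + 1 := by positivity
  have hint := int_aux (ε / P) (ε / PS) (ε * P / PS) hpos.ne'
  have ha : 0 ≤ ε / P := by positivity
  have hg : ∀ x, 0 ≤ x → 0 ≤ 1 - Real.exp (-(ε * P / PS * x + ε / PS)) := by
    intro x hx
    have : 0 ≤ ε * P / PS * x + ε / PS := by positivity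
    have := Real.exp_le_one_iff.2 (neg_nonpos.2 this)
    linarith
  have hR : 1 - Real.exp (-ε / P)
        - Real.exp (-ε / PS) * (1 - Real.exp (-(ε * P / PS + 1) * ε / P))
          / (ε * P / PS + 1) = ∫ x in Set.Icc (0:ℝ) (ε / P),
            Real.exp (-x) * (1 - Real.exp (-(ε * P / PS * x + ε / PS))) := by
    rw [integral_Icc_eq_integral_Ioc, ← intervalIntegral.integral_of_le ha, hint, neg_div,
      neg_div, mul_div_assoc (-(ε * P / PS + 1))]
  have hmeas := measurable_measure_prodMk_left (ν := expMeasure 1) hm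
  have hpdf : Measurable (gammaPDF 1 1) := (measurable_gammaPDFReal 1 1).ennreal_ofReal
  rw [h1, hR, Measure.prod_apply hm]
  conv_lhs => rw [expMeasure, gammaMeasure]
  change ∫⁻ x, (expMeasure 1) (Prod.mk x ⁻¹' _) ∂(volume.withDensity (gammaPDF 1 1)) = _
  rw [lintegral_withDensity_eq_lintegral_mul _ hpdf hmeas,
    ofReal_integral_eq_lintegral_ofReal
      (Continuous.integrableOn_Icc (by fun_prop))
      ((ae_restrict_iff' measurableSet_Icc).2 (Filter.Eventually.of_forall fun x hx =>
        mul_nonneg (Real.exp_pos _).le (hg x hx.1))),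
    ← lintegral_indicator measurableSet_Icc]
  refine lintegral_congr fun x => ?_
  simp only [Pi.mul_apply]
  by_cases hx : x ∈ Set.Icc 0 (ε / P)
  · rw [Set.indicator_of_mem hx]
    have hs : Prod.mk x ⁻¹' {p : ℝ × ℝ | P * p.1 ≤ ε ∧ PS * p.2 ≤ ε * (P * p.1 + 1)}
        = Set.Iic (ε * P / PS * x + ε / PS) := by
      ext y
      have e : ε * P / PS * x + ε / PS = ε * (P * x + 1) / PS := by field_simp
      have hx2 : P * x ≤ ε := by rw [mul_comm]; exact (le_div_iff₀ hP).1 hx.2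
      simp only [Set.mem_preimage, Set.mem_ofPred_eq, Set.mem_Iic, e, le_div_iff₀ hPS, hx2,
        true_and, mul_comm y PS]
    have hx0 := hx.1
    rw [hs, expM_Iic _ (by positivity), ENNReal.ofReal_mul (Real.exp_pos _).le]
    congr 1
    have := exponentialPDF_of_nonneg (r := 1) hx.1
    simpa [exponentialPDF, exponentialPDFReal, gammaPDF] using this
  · rw [Set.indicator_of_notMem hx]
    by_cases h0 : 0 ≤ x
    · have hs : Prod.mk x ⁻¹' {p : ℝ × ℝ | P * p.1 ≤ ε ∧ PS * p.2 ≤ ε * (P * p.1 + 1)} = ∅ := by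
        ext y
        simp only [Set.mem_preimage, Set.mem_ofPred_eq, Set.mem_empty_iff_false, iff_false]
        rintro ⟨h, -⟩
        exact hx ⟨h0, (le_div_iff₀ hP).2 (by rwa [mul_comm])⟩
      rw [hs, measure_empty, mul_zero]
    · rw [gammaPDF_of_neg (not_le.1 h0), zero_mul]
end

section
/- Let X and Y be independent random variables, each exponentially distributed with rate 1, and let P, P^S, ε > 0 be reals. Then P( P·X ≤ ε and P^S·Y ≥ ε·(P·X + 1) ) = e^{−ε/P^S} · (1 − e^{−(ε·P/P^S + 1)·ε/P}) / (ε·P/P^S + 1). -/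
open MeasureTheory ProbabilityTheory

lemma aux_exp : expMeasure 1 = (volume : Measure ℝ).withDensity (exponentialPDF 1) := rfl

lemma aux_meas : Measurable (exponentialPDF 1) :=
  (measurable_exponentialPDFReal 1).ennreal_ofReal

lemma aux_tail (a : ℝ) (ha : 0 ≤ a) :
    expMeasure 1 (Set.Ici a) = ENNReal.ofReal (Real.exp (-a)) := by
  rw [aux_exp, withDensity_apply _ measurableSet_Ici, ← integral_exp_neg_Ioi,
    ofReal_integral_eq_lintegral_ofReal (integrableOn_exp_neg_Ioi a)
      (Filter.Eventually.of_forall fun x => (Real.exp_pos _).le),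
    setLIntegral_congr Ioi_ae_eq_Ici]
  refine setLIntegral_congr_fun measurableSet_Ici fun x hx => ?_
  rw [exponentialPDF_of_nonneg (ha.trans hx)]
  simp

lemma aux_int (c b : ℝ) (hc : 0 < c) :
    ∫ x in (0:ℝ)..b, Real.exp (-c * x) = (1 - Real.exp (-c * b)) / c := by
  rw [intervalIntegral.integral_comp_mul_left (fun x => Real.exp x) (neg_ne_zero.2 hc.ne'),
    integral_exp]
  simp
  field_simp
  ring

/-- Probability P(E2) of equation (38): for independent exponential(1) random
variables X, Y, P(P·X ≤ ε and P^S·Y ≥ ε·(P·X + 1))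
= e^{−ε/P^S}·(1 − e^{−(ε·P/P^S + 1)·ε/P})/(ε·P/P^S + 1). -/
theorem stmt_8 {Ω : Type*} [MeasurableSpace Ω] (μ : Measure Ω) [IsProbabilityMeasure μ]
    (X Y : Ω → ℝ) (hX : Measurable X) (hY : Measurable Y)
    (hindep : IndepFun X Y μ)
    (hXd : Measure.map X μ = expMeasure 1) (hYd : Measure.map Y μ = expMeasure 1)
    (P PS ε : ℝ) (hP : 0 < P) (hPS : 0 < PS) (hε : 0 < ε) :
    μ {ω | P * X ω ≤ ε ∧ ε * (P * X ω + 1) ≤ PS * Y ω} =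
      ENNReal.ofReal (Real.exp (-ε / PS) * (1 - Real.exp (-(ε * P / PS + 1) * ε / P))
        / (ε * P / PS + 1)) := by
  have hc : 0 < ε * P / PS + 1 := by positivity
  set c := ε * P / PS + 1 with hcdef
  have hb : 0 ≤ ε / P := by positivity
  haveI := isProbabilityMeasure_expMeasure (r := 1) one_pos
  have hS : MeasurableSet {p : ℝ × ℝ | P * p.1 ≤ ε ∧ ε * (P * p.1 + 1) ≤ PS * p.2} := by
    have a1 : MeasurableSet {p : ℝ × ℝ | P * p.1 ≤ ε} :=
      measurableSet_le (f := fun p : ℝ × ℝ => P * p.1) (g := fun _ => ε) (by fun_prop) (by fun_prop)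
    have a2 : MeasurableSet {p : ℝ × ℝ | ε * (P * p.1 + 1) ≤ PS * p.2} :=
      measurableSet_le (f := fun p : ℝ × ℝ => ε * (P * p.1 + 1)) (g := fun p => PS * p.2)
        (by fun_prop) (by fun_prop)
    exact a1.inter a2
  have h1 := (indepFun_iff_map_prod_eq_prod_map_map hX.aemeasurable hY.aemeasurable).1 hindep
  rw [hXd, hYd] at h1
  have h2 : μ {ω | P * X ω ≤ ε ∧ ε * (P * X ω + 1) ≤ PS * Y ω} =
      ((expMeasure 1).prod (expMeasure 1))
        {p : ℝ × ℝ | P * p.1 ≤ ε ∧ ε * (P * p.1 + 1) ≤ PS * p.2} := by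
    rw [← h1, Measure.map_apply (hX.prodMk hY) hS]
    rfl
  have h3 : (∫⁻ x, expMeasure 1 (Prod.mk x ⁻¹'
        {p : ℝ × ℝ | P * p.1 ≤ ε ∧ ε * (P * p.1 + 1) ≤ PS * p.2}) ∂(expMeasure 1)) =
      ∫⁻ x in Set.Icc 0 (ε / P),
        ENNReal.ofReal (Real.exp (-ε / PS) * Real.exp (-c * x)) := by
    conv_lhs => rw [aux_exp]
    rw [lintegral_withDensity_eq_lintegral_mul _ aux_meas (measurable_measure_prodMk_left hS),
      ← lintegral_indicator measurableSet_Icc]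
    congr 1
    ext x
    simp only [Pi.mul_apply, ← aux_exp]
    by_cases hx0 : 0 ≤ x
    · by_cases hx1 : x ≤ ε / P
      · have hx2 : P * x ≤ ε := by rw [le_div_iff₀ hP] at hx1; linarith
        rw [Set.indicator_of_mem (Set.mem_Icc.2 ⟨hx0, hx1⟩), exponentialPDF_of_nonneg hx0]
        have : (Prod.mk x ⁻¹' {p : ℝ × ℝ | P * p.1 ≤ ε ∧ ε * (P * p.1 + 1) ≤ PS * p.2})
            = Set.Ici (ε * (P * x + 1) / PS) := by
          ext y
          simp only [Set.mem_preimage, Set.mem_setOf_eq, Set.mem_Ici, hx2, true_and]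
          rw [div_le_iff₀ hPS, mul_comm y]
        rw [this, aux_tail _ (by positivity), ← ENNReal.ofReal_mul (by positivity)]
        congr 1
        rw [one_mul, ← Real.exp_add, ← Real.exp_add]
        congr 1
        rw [hcdef]
        field_simp
        ring
      · have hx2 : ¬ P * x ≤ ε := by
          rw [le_div_iff₀ hP] at hx1; intro h; apply hx1; linarith
        rw [Set.indicator_of_notMem (fun h => hx1 h.2)]
        simp [hx2]
    · rw [Set.indicator_of_notMem (fun h => hx0 h.1), exponentialPDF_of_neg (not_le.1 hx0),
        zero_mul]
  rw [h2, Measure.prod_apply hS, h3, ← ofReal_integral_eq_lintegral_ofReal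
      (Continuous.integrableOn_Icc (by fun_prop))
      (Filter.Eventually.of_forall fun x => by positivity),
    integral_Icc_eq_integral_Ioc, ← intervalIntegral.integral_of_le hb,
    intervalIntegral.integral_const_mul, aux_int c _ hc, mul_div_assoc, mul_div_assoc]
end

section
/- Let M, T, ε > 0 be real constants and define, for P > 0, pm(P) := e^{−ε/P}, pm'(P) := (1 − e^{−ε/P})·e^{−ε/P}/(1 + ε), and p0(P) := (1 − e^{−ε/P})·(1 − e^{−ε/P}/(1 + ε)). Let Δ(x, y, z) := (M·T/4)·(2·(y+z)²·(1+x) + y·z·(1−x)²)/((y+z)²·(1−x)). Then lim_{P→∞} [ T + Δ(p0(P), pm(P), pm'(P)) ] = T + M·T/2, and also lim_{P→∞} [ T + (M·T/2)·(2·e^{ε/P} − 1) ] = T + M·T/2; hence the difference of the two expressions tends to 0 as P → ∞. -/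
open Filter

/-- Corollary 1 of the paper: under the generate-at-will model with P^S = P,
the CR-NOMA AoI T + Δ(p0(P), pm(P), pm'(P)) and the TDMA AoI
T + (M·T/2)·(2·e^{ε/P} − 1) both tend to T + M·T/2 as P → ∞; hence their
difference tends to 0. -/
theorem stmt_13 (M T ε : ℝ) (hM : 0 < M) (hT : 0 < T) (hε : 0 < ε)
    (pm pm' p0 : ℝ → ℝ) (Δ : ℝ → ℝ → ℝ → ℝ)
    (hpm : ∀ P, pm P = Real.exp (-ε / P))
    (hpm' : ∀ P, pm' P = (1 - Real.exp (-ε / P)) * Real.exp (-ε / P) / (1 + ε))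
    (hp0 : ∀ P, p0 P = (1 - Real.exp (-ε / P)) * (1 - Real.exp (-ε / P) / (1 + ε)))
    (hΔ : ∀ x y z, Δ x y z =
        (M * T / 4) * (2 * (y + z) ^ 2 * (1 + x) + y * z * (1 - x) ^ 2)
          / ((y + z) ^ 2 * (1 - x))) :
    Tendsto (fun P : ℝ => T + Δ (p0 P) (pm P) (pm' P)) atTop (nhds (T + M * T / 2)) ∧
    Tendsto (fun P : ℝ => T + (M * T / 2) * (2 * Real.exp (ε / P) - 1)) atTop
      (nhds (T + M * T / 2)) ∧
    Tendsto (fun P : ℝ => (T + Δ (p0 P) (pm P) (pm' P))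
        - (T + (M * T / 2) * (2 * Real.exp (ε / P) - 1))) atTop (nhds 0) := by
  have hE : ∀ c : ℝ, Tendsto (fun P : ℝ => Real.exp (c / P)) atTop (nhds 1) := by
    intro c
    have h : Tendsto (fun P : ℝ => c / P) atTop (nhds 0) :=
      tendsto_const_nhds.div_atTop tendsto_id
    have h2 := (Real.continuous_exp.tendsto 0).comp h
    rw [Real.exp_zero] at h2
    exact h2
  have h1 : Tendsto (fun P : ℝ => T + Δ (p0 P) (pm P) (pm' P)) atTop
      (nhds (T + M * T / 2)) := by
    have hy : Tendsto pm atTop (nhds 1) := by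
      rw [funext hpm]
      exact hE _
    have hz : Tendsto pm' atTop (nhds 0) := by
      rw [funext hpm']
      have := (((hE (-ε)).const_sub 1).mul (hE (-ε))).div_const (1 + ε)
      simpa using this
    have hx : Tendsto p0 atTop (nhds 0) := by
      rw [funext hp0]
      have := ((hE (-ε)).const_sub 1).mul (((hE (-ε)).div_const (1 + ε)).const_sub 1)
      simpa using this
    simp only [hΔ]
    have hn := ((((hy.add hz).pow 2).const_mul 2).mul (hx.const_add 1)).add
      ((hy.mul hz).mul ((hx.const_sub 1).pow 2))
    have hd := ((hy.add hz).pow 2).mul (hx.const_sub 1)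
    have := ((hn.const_mul (M * T / 4)).div hd (by norm_num)).const_add T
    have e : T + M * T / 2 = T + M * T / 4 * (2 * (1 + 0) ^ 2 * (1 + 0) + 1 * 0 * (1 - 0) ^ 2) / ((1 + 0) ^ 2 * (1 - 0)) := by
      norm_num
      ring
    rw [e]
    exact this
  have h2 : Tendsto (fun P : ℝ => T + (M * T / 2) * (2 * Real.exp (ε / P) - 1)) atTop
      (nhds (T + M * T / 2)) := by
    have := ((((hE ε).const_mul 2).sub_const 1).const_mul (M * T / 2)).const_add T
    convert this using 2
    ring
  refine ⟨h1, h2, ?_⟩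
  have := h1.sub h2
  rwa [sub_self] at this
end

section
/- Let M, T, ε > 0 and let m > 0 with m' := m + M/2. For P > 0 define p0(P) := (1 − e^{−ε/P}/(1 + ε))·(1 − e^{−ε/P}), pm(P) := e^{−ε/P}/(1 + ε), pm'(P) := (1 − e^{−ε/P}/(1 + ε))·e^{−ε/P}, Δ(x,y,z) := (M·T/4)·(2·(y+z)²·(1+x) + y·z·(1−x)²)/((y+z)²·(1−x)), and Δ₀(P) := ((1 − p0)²/(pm + pm')²)·[ (pm + pm')·m·T·pm/(1 − p0)² + (pm'/2)·m·T·pm/(1 − p0) + (pm + pm')·m'·T·pm'/(1 − p0)² − (pm/2)·m'·T·pm'/(1 − p0) ] evaluated at p0 = p0(P), pm = pm(P), pm' = pm'(P). Then lim_{P→∞} [ Δ₀(P) + Δ(p0(P), pm(P), pm'(P)) ] = (m·T + m'·T·ε)/(1 + ε) + M·T/2. -/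
open Filter

/-- First part of Corollary 2: under the generate-at-request model with
P^S = P, user U_{m'}'s CR-NOMA average AoI Δ₀(P) + Δ(p0(P), pm(P), pm'(P))
tends to (m·T + m'·T·ε)/(1 + ε) + M·T/2 as P → ∞. -/
theorem stmt_17 (M T ε m m' : ℝ) (hM : 0 < M) (hT : 0 < T) (hε : 0 < ε)
    (hm : 0 < m) (hm' : m' = m + M / 2)
    (p0 pm pm' Δ0 : ℝ → ℝ) (Δ : ℝ → ℝ → ℝ → ℝ)
    (hp0 : ∀ P, p0 P = (1 - Real.exp (-ε / P) / (1 + ε)) * (1 - Real.exp (-ε / P)))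
    (hpm : ∀ P, pm P = Real.exp (-ε / P) / (1 + ε))
    (hpm' : ∀ P, pm' P = (1 - Real.exp (-ε / P) / (1 + ε)) * Real.exp (-ε / P))
    (hΔ : ∀ x y z, Δ x y z =
        (M * T / 4) * (2 * (y + z) ^ 2 * (1 + x) + y * z * (1 - x) ^ 2)
          / ((y + z) ^ 2 * (1 - x)))
    (hΔ0 : ∀ P, Δ0 P =
        ((1 - p0 P) ^ 2 / (pm P + pm' P) ^ 2)
          * ((pm P + pm' P) * (m * T * pm P) / (1 - p0 P) ^ 2
            + (pm' P / 2) * (m * T * pm P) / (1 - p0 P)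
            + (pm P + pm' P) * (m' * T * pm' P) / (1 - p0 P) ^ 2
            - (pm P / 2) * (m' * T * pm' P) / (1 - p0 P))) :
    Tendsto (fun P : ℝ => Δ0 P + Δ (p0 P) (pm P) (pm' P)) atTop
      (nhds ((m * T + m' * T * ε) / (1 + ε) + M * T / 2)) := by
  have hE : Tendsto (fun P : ℝ => Real.exp (-ε / P)) atTop (nhds 1) := by
    have h := (Real.continuous_exp.tendsto 0).comp
      (tendsto_const_nhds (x := -ε).div_atTop (tendsto_id (α := ℝ) (x := atTop)))
    simpa [Function.comp_def] using h
  have hne : (1 + ε) ≠ 0 := by positivity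
  have h0 : Tendsto p0 atTop (nhds 0) := by
    rw [funext hp0]
    have h := (tendsto_const_nhds (x := (1:ℝ)).sub (hE.div_const (1 + ε))).mul
      (tendsto_const_nhds (x := (1:ℝ)).sub hE)
    simpa using h
  have h1 : Tendsto pm atTop (nhds (1 / (1 + ε))) := by
    rw [funext hpm]
    exact hE.div_const (1 + ε)
  have h2 : Tendsto pm' atTop (nhds (ε / (1 + ε))) := by
    rw [funext hpm']
    have h := (tendsto_const_nhds (x := (1:ℝ)).sub (hE.div_const (1 + ε))).mul hE
    convert h using 2
    field_simp
    ring
  have h3 : Tendsto (fun P => pm P + pm' P) atTop (nhds 1) := by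
    convert h1.add h2 using 2
    field_simp
  have h4 : Tendsto (fun P => 1 - p0 P) atTop (nhds 1) := by
    simpa using tendsto_const_nhds (x := (1:ℝ)).sub h0
  have h5 : Tendsto (fun P => 1 + p0 P) atTop (nhds 1) := by
    simpa using tendsto_const_nhds (x := (1:ℝ)).add h0
  have hA := ((h4.pow 2).div (h3.pow 2) (by norm_num)).mul
    (((((h3.mul (h1.const_mul (m * T))).div (h4.pow 2) (by norm_num)).add
      (((h2.div_const 2).mul (h1.const_mul (m * T))).div h4 (by norm_num))).add
      ((h3.mul (h2.const_mul (m' * T))).div (h4.pow 2) (by norm_num))).sub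
      (((h1.div_const 2).mul (h2.const_mul (m' * T))).div h4 (by norm_num)))
  have hB := (((((h3.pow 2).const_mul 2).mul h5).add
      ((h1.mul h2).mul (h4.pow 2))).const_mul (M * T / 4)).div
      ((h3.pow 2).mul h4) (by norm_num)
  have hC := hA.add hB
  simp only [hΔ, hΔ0]
  simp only [Pi.div_apply] at hC
  convert hC using 2
  subst hm'
  field_simp
  ring
end

section
/- Let M, T, ε > 0 and let m > 0 with m' := m + M/2. Then [ (m·T + m'·T·ε)/(1 + ε) + M·T/2 ] − [ m'·T + M·T/2 ] = − M·T/(2·(1 + ε)), which is strictly negative. Consequently, if f(P) denotes user U_{m'}'s CR-NOMA average AoI expression from Lemma 2 (which tends to (m·T + m'·T·ε)/(1 + ε) + M·T/2 as P → ∞) and g(P) := m'·T + (M·T/2)·(2·e^{ε/P} − 1) denotes U_{m'}'s TDMA average AoI (which tends to m'·T + M·T/2), then lim_{P→∞} ( f(P) − g(P) ) = − M·T/(2·(1 + ε)) < 0. -/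
open Filter

/-- Conclusion of Corollary 2 for user U_{m'}: the high-SNR CR-NOMA AoI limit
minus the high-SNR TDMA AoI limit equals −M·T/(2·(1 + ε)) < 0; consequently,
if f(P) → (m·T + m'·T·ε)/(1 + ε) + M·T/2 (the CR-NOMA AoI) and
g(P) = m'·T + (M·T/2)·(2·e^{ε/P} − 1) (the TDMA AoI), then
f(P) − g(P) → −M·T/(2·(1 + ε)) < 0. -/
theorem stmt_18 (M T ε m m' : ℝ) (hM : 0 < M) (hT : 0 < T) (hε : 0 < ε)
    (hm : 0 < m) (hm' : m' = m + M / 2) :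
    (((m * T + m' * T * ε) / (1 + ε) + M * T / 2) - (m' * T + M * T / 2)
        = -(M * T / (2 * (1 + ε))) ∧
      -(M * T / (2 * (1 + ε))) < 0) ∧
    ∀ f g : ℝ → ℝ,
      Tendsto f atTop (nhds ((m * T + m' * T * ε) / (1 + ε) + M * T / 2)) →
      (∀ P, g P = m' * T + (M * T / 2) * (2 * Real.exp (ε / P) - 1)) →
      Tendsto (fun P : ℝ => f P - g P) atTop (nhds (-(M * T / (2 * (1 + ε))))) := by
  have h1 : (1 + ε) ≠ 0 := by positivity
  have key : ((m * T + m' * T * ε) / (1 + ε) + M * T / 2) - (m' * T + M * T / 2)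
        = -(M * T / (2 * (1 + ε))) := by
    subst hm'
    field_simp
    ring
  refine ⟨⟨key, neg_lt_zero.mpr (by positivity)⟩, ?_⟩
  intro f g hf hg
  have h0 : Tendsto (fun P : ℝ => ε / P) atTop (nhds 0) :=
    tendsto_const_nhds.div_atTop tendsto_id
  have he : Tendsto (fun P : ℝ => Real.exp (ε / P)) atTop (nhds 1) := by
    have h := (Real.continuous_exp.tendsto 0).comp h0
    rw [Real.exp_zero] at h
    exact h
  have hgl : Tendsto g atTop (nhds (m' * T + M * T / 2)) := by
    have h := (((he.const_mul 2).sub_const 1).const_mul (M * T / 2)).const_add (m' * T)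
    have e : m' * T + M * T / 2 = m' * T + M * T / 2 * (2 * 1 - 1) := by ring
    rw [e, funext hg]
    exact h
  rw [← key]
  exact hf.sub hgl
end
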